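/- Let t = (t^{(a)}_j), a = 0,…,N−1, j = 1,…,l_a, be complex numbers such that for each a the numbers t^{(a)}_1,…,t^{(a)}_{l_a} are pairwise distinct, for each a = 1,…,N−1 the sets {t^{(a−1)}_{j'}} and {t^{(a)}_j} are disjoint, and t satisfies the Bethe ansatz equations. Then there exists a unique subspace X ∈ Ω_λ such that y_a(u) = ∏_{j=1}^{l_a}(u − t^{(a)}_j) for every a = 0,…,N−1; moreover this X is generic and t are its root coordinates. -/

import Mathlib

open Polynomial

noncomputable section

/-- `d i = λ i + N - i` (0-based indexing: `d i = lam i + (N - 1 - i)`). -/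
def degSeq (N : ℕ) (lam : Fin N → ℕ) (i : Fin N) : ℕ :=
  lam i + (N - 1 - (i : ℕ))

/-- The Schubert cell `Ω_λ`. -/
def Omega (N : ℕ) (lam : Fin N → ℕ) : Set (Submodule ℂ (Polynomial ℂ)) :=
  {X | Module.finrank ℂ X = N ∧
    ∀ i : Fin N, ∃ p ∈ X, p.degree = (degSeq N lam i : ℕ)}

/-- `l a = λ_{a+1} + … + λ_N` (0-based: sum of `lam b` over `b ≥ a`); note `l N = 0`. -/
def lseq (N : ℕ) (lam : Fin N → ℕ) (a : ℕ) : ℕ :=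
  ∑ b ∈ Finset.univ.filter (fun b : Fin N => a ≤ (b : ℕ)), lam b

/-- The Wronskian `Wr(g_1, …, g_r)`. -/
noncomputable def wronskian {r : ℕ} (g : Fin r → Polynomial ℂ) : Polynomial ℂ :=
  (Matrix.of fun i j : Fin r =>
    (⇑Polynomial.derivative : Polynomial ℂ → Polynomial ℂ)^[(j : ℕ)] (g i)).det

/-- The Wronskian `Wr(f_{a+1}, …, f_N)` of the tail of a tuple (0-based: tail from index `a`). -/
noncomputable def wrTail {N : ℕ} (f : Fin N → Polynomial ℂ) (a : ℕ) : Polynomial ℂ :=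
  wronskian (fun s : Fin (N - a) => f ⟨a + (s : ℕ), by have := s.isLt; omega⟩)

/-- `f` is a flag basis of `X ∈ Ω_λ`. -/
def IsFlagBasis (N : ℕ) (lam : Fin N → ℕ) (X : Submodule ℂ (Polynomial ℂ))
    (f : Fin N → Polynomial ℂ) : Prop :=
  LinearIndependent ℂ f ∧ Submodule.span ℂ (Set.range f) = X ∧
    ∀ i : Fin N, (f i).Monic ∧ (f i).natDegree = degSeq N lam i ∧
      ∀ j : Fin N, j ≠ i → (f i).coeff (degSeq N lam j) = 0

/-- The Bethe ansatz equations. -/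
def BAE (N : ℕ) (lam : Fin N → ℕ) (t : (a : ℕ) → Fin (lseq N lam a) → ℂ) : Prop :=
  ∀ a : ℕ, 1 ≤ a → a < N → ∀ j : Fin (lseq N lam a),
    (∑ j' : Fin (lseq N lam (a - 1)), 1 / (t a j - t (a - 1) j')) -
    (∑ j' ∈ Finset.univ.filter (fun j' : Fin (lseq N lam a) => j' ≠ j), 2 / (t a j - t a j')) +
    (∑ j' : Fin (lseq N lam (a + 1)), 1 / (t a j - t (a + 1) j')) = 0

/-- The Wronskian matrix of a tuple of polynomials. -/
def wrMatrix {r : ℕ} (g : Fin r → ℂ[X]) : Matrix (Fin r) (Fin r) ℂ[X] :=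
  Matrix.of fun i j => derivative^[(j : ℕ)] (g i)

lemma wronskian_eq_det_wrMatrix {r : ℕ} (g : Fin r → ℂ[X]) :
    _root_.wronskian g = (wrMatrix g).det := rfl

lemma Matrix.natDegree_det_le_and_coeff_det {n R : Type*} [DecidableEq n] [Fintype n] [CommRing R]
    (B : Matrix n n R[X]) (e : n → ℕ) (h : ∀ i j, (B i j).natDegree ≤ e i) :
    B.det.natDegree ≤ ∑ i, e i ∧
      B.det.coeff (∑ i, e i) = (Matrix.of fun i j => (B i j).coeff (e i)).det := by
  have key : ∀ (s : Finset n) (p : n → R[X]) (d : n → ℕ), (∀ i, (p i).natDegree ≤ d i) →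
      (∏ i ∈ s, p i).natDegree ≤ ∑ i ∈ s, d i ∧
      (∏ i ∈ s, p i).coeff (∑ i ∈ s, d i) = ∏ i ∈ s, (p i).coeff (d i) := by
    intro s p d hp
    induction s using Finset.induction_on with
    | empty => simp
    | insert a s ha ih =>
      rw [Finset.prod_insert ha, Finset.sum_insert ha, Finset.prod_insert ha]
      exact ⟨natDegree_mul_le_of_le (hp a) ih.1,
        by rw [coeff_mul_add_eq_of_natDegree_le (hp a) ih.1, ih.2]⟩
  have hs : ∀ σ : Equiv.Perm n, ∑ i, e (σ i) = ∑ i, e i := fun σ => Equiv.sum_comp σ e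
  have key' := fun σ : Equiv.Perm n =>
    key Finset.univ (fun i => B (σ i) i) (fun i => e (σ i)) (fun i => h _ _)
  constructor
  · rw [Matrix.det_apply]
    refine natDegree_sum_le_of_forall_le _ _ fun σ _ => ?_
    refine (natDegree_smul_le _ _).trans ?_
    rw [← hs σ]
    exact (key' σ).1
  · rw [Matrix.det_apply, Matrix.det_apply, finsetSum_coeff]
    refine Finset.sum_congr rfl fun σ _ => ?_
    rw [coeff_smul, ← hs σ, (key' σ).2]
    rfl

lemma natDegree_X_pow_mul_iterate_derivative_le {f : ℂ[X]} {e : ℕ} (hf : f.natDegree ≤ e) (j : ℕ) :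
    (X ^ j * derivative^[j] f).natDegree ≤ e := by
  by_cases hj : j ≤ e
  · have h1 := natDegree_iterate_derivative f j
    have h2 := natDegree_mul_le_of_le (natDegree_X_pow_le (R := ℂ) j) h1
    omega
  · rw [iterate_derivative_eq_zero (by omega)]
    simp

lemma coeff_X_pow_mul_iterate_derivative (f : ℂ[X]) (e j : ℕ) :
    (X ^ j * derivative^[j] f).coeff e = (e.descFactorial j : ℂ) * f.coeff e := by
  rw [coeff_X_pow_mul']
  split_ifs with h
  · rw [coeff_iterate_derivative, Nat.sub_add_cancel h, nsmul_eq_mul]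
  · rw [Nat.descFactorial_of_lt (by omega)]
    simp

lemma wronskian_mul_X_pow {r : ℕ} (g : Fin r → ℂ[X]) :
    _root_.wronskian g * X ^ (∑ j : Fin r, (j : ℕ)) =
      (Matrix.of fun i j : Fin r => X ^ (j : ℕ) * derivative^[(j : ℕ)] (g i)).det := by
  have := Matrix.det_mul_row (fun j : Fin r => (X : ℂ[X]) ^ (j : ℕ)) (wrMatrix g)
  rw [wronskian_eq_det_wrMatrix, mul_comm, ← Finset.prod_pow_eq_pow_sum, ← this]
  rfl

lemma det_descFactorial_ne_zero {r : ℕ} {e : Fin r → ℕ} (he : Function.Injective e) :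
    (Matrix.of fun i j : Fin r => ((e i).descFactorial (j : ℕ) : ℂ)).det ≠ 0 := by
  have h := Matrix.det_eval_matrixOfPolynomials_eq_det_vandermonde (fun i => (e i : ℂ))
    (fun i => descPochhammer ℂ i) (fun i => descPochhammer_natDegree ℂ i)
    (fun i => monic_descPochhammer ℂ i)
  simp only [descPochhammer_eval_eq_descFactorial] at h
  rw [← h, Matrix.det_vandermonde_ne_zero_iff]
  exact Nat.cast_injective.comp he

/-- Polynomials of pairwise distinct degrees have a nonzero Wronskian, of the expected degree. -/
lemma wronskian_ne_zero_and_natDegree {r : ℕ} {g : Fin r → ℂ[X]} (h0 : ∀ i, g i ≠ 0)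
    (he : Function.Injective fun i => (g i).natDegree) :
    _root_.wronskian g ≠ 0 ∧
      (_root_.wronskian g).natDegree + ∑ j : Fin r, (j : ℕ) = ∑ i, (g i).natDegree := by
  obtain ⟨h1, h2⟩ := Matrix.natDegree_det_le_and_coeff_det
    (Matrix.of fun i j : Fin r => X ^ (j : ℕ) * derivative^[(j : ℕ)] (g i))
    (fun i => (g i).natDegree)
    (fun i j => natDegree_X_pow_mul_iterate_derivative_le le_rfl _)
  rw [← wronskian_mul_X_pow] at h1 h2
  simp only [Matrix.of_apply, coeff_X_pow_mul_iterate_derivative] at h2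
  have h3 := Matrix.det_mul_column (fun i => (g i).coeff (g i).natDegree)
    (Matrix.of fun i j : Fin r => ((g i).natDegree.descFactorial (j : ℕ) : ℂ))
  simp only [Matrix.of_apply] at h3
  simp only [mul_comm ((Nat.descFactorial _ _ : ℕ) : ℂ)] at h2
  rw [h3] at h2
  have h4 : (_root_.wronskian g * X ^ (∑ j : Fin r, (j : ℕ))).coeff (∑ i, (g i).natDegree) ≠ 0 := by
    rw [h2]
    exact mul_ne_zero (Finset.prod_ne_zero_iff.2 fun i _ => by simpa using h0 i)
      (det_descFactorial_ne_zero he)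
  have h5 : _root_.wronskian g ≠ 0 := by
    intro h
    simp [h] at h4
  refine ⟨h5, ?_⟩
  rw [← natDegree_mul_X_pow _ h5]
  exact le_antisymm h1 (le_natDegree_of_ne_zero h4)

/-- The linear differential operator `f ↦ Wr(f, v_1, …, v_r)`. -/
def wrMap {r : ℕ} (v : Fin r → ℂ[X]) : ℂ[X] →ₗ[ℂ] ℂ[X] where
  toFun f := _root_.wronskian (Fin.cons f v : Fin (r + 1) → ℂ[X])
  map_add' f g := by
    simp only [wronskian_eq_det_wrMatrix]
    rw [Matrix.det_succ_row_zero, Matrix.det_succ_row_zero, Matrix.det_succ_row_zero,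
      ← Finset.sum_add_distrib]
    refine Finset.sum_congr rfl fun j _ => ?_
    simp only [wrMatrix, Matrix.of_apply, Fin.cons_zero, iterate_map_add]
    simp only [Matrix.submatrix, Matrix.of_apply, Fin.cons_succ]
    ring
  map_smul' c f := by
    simp only [wronskian_eq_det_wrMatrix]
    rw [Matrix.det_succ_row_zero, Matrix.det_succ_row_zero, Finset.smul_sum]
    refine Finset.sum_congr rfl fun j _ => ?_
    simp only [wrMatrix, Matrix.of_apply, Fin.cons_zero, iterate_derivative_smul]
    simp only [Matrix.submatrix, Matrix.of_apply, Fin.cons_succ, RingHom.id_apply, smul_eq_C_mul]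
    ring

lemma wrMap_apply {r : ℕ} (v : Fin r → ℂ[X]) (f : ℂ[X]) :
    wrMap v f = _root_.wronskian (Fin.cons f v : Fin (r + 1) → ℂ[X]) := rfl

/-- The derivative of a determinant, column by column. -/
lemma Matrix.derivative_det {n R : Type*} [DecidableEq n] [Fintype n] [CommRing R]
    (B : Matrix n n R[X]) :
    derivative B.det = ∑ k, (B.updateCol k fun i => derivative (B i k)).det := by
  simp only [Matrix.det_apply]
  rw [derivative_sum, Finset.sum_comm]
  refine Finset.sum_congr rfl fun σ _ => ?_
  rw [derivative_smul, derivative_prod_finset, Finset.smul_sum]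
  refine Finset.sum_congr rfl fun k _ => ?_
  congr 1
  rw [← Finset.mul_prod_erase _ _ (Finset.mem_univ k), mul_comm]
  congr 1
  · simp
  · refine Finset.prod_congr rfl fun i hi => ?_
    rw [Matrix.updateCol_ne (Finset.ne_of_mem_erase hi)]

/-- The derivative of a Wronskian: differentiate the last column once more. -/
lemma derivative_wronskian {s : ℕ} (g : Fin (s + 1) → ℂ[X]) :
    derivative (_root_.wronskian g) = (Matrix.of fun i j : Fin (s + 1) =>
      derivative^[((Fin.last s).castSucc.succAbove j : ℕ)] (g i)).det := by
  rw [wronskian_eq_det_wrMatrix, Matrix.derivative_det, Fin.sum_univ_castSucc,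
    Finset.sum_eq_zero, zero_add]
  · congr 1
    ext i j : 2
    refine Fin.lastCases ?_ (fun j => ?_) j
    · simp [wrMatrix, Function.iterate_succ_apply']
    · rw [Matrix.updateCol_ne (Fin.castSucc_lt_last j).ne, Matrix.of_apply,
        Fin.succAbove_of_castSucc_lt _ _ (by simp [Fin.castSucc_lt_last])]
      rfl
  · intro k _
    refine Matrix.det_zero_of_column_eq (i := k.castSucc) (j := k.succ)
      (Fin.castSucc_lt_succ).ne fun i => ?_
    rw [Matrix.updateCol_self, Matrix.updateCol_ne (Fin.castSucc_lt_succ).ne']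
    simp [wrMatrix, Function.iterate_succ_apply']

/-- The Desnanot–Jacobi identity, multiplied by the determinant. -/
lemma Matrix.adjugate_minor_mul_det {n R : Type*} [DecidableEq n] [Fintype n] [CommRing R]
    (M : Matrix n n R) {p q : n} (hpq : p ≠ q) (i k : n) :
    M.det * (M.adjugate p i * M.adjugate q k - M.adjugate p k * M.adjugate q i) =
      M.det * (M.det * ((M.updateCol p (Pi.single i 1)).updateCol q (Pi.single k 1)).det) := by
  set A := M.adjugate with hA
  have hMA : ∀ x y, ∑ j, M x j * A j y = M.det * (Pi.single y 1 : n → R) x := by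
    intro x y
    have := congrFun (congrFun M.mul_adjugate x) y
    rw [Matrix.mul_apply] at this
    rw [hA, this, Matrix.smul_apply, Matrix.one_apply, Pi.single_apply, smul_eq_mul]
  let U : Matrix n (Fin 2) R := Matrix.of fun x =>
    ![A x i - (Pi.single p 1 : n → R) x, A x k - (Pi.single q 1 : n → R) x]
  let V : Matrix (Fin 2) n R := Matrix.of ![Pi.single p 1, Pi.single q 1]
  have hN : (1 + U * V).det = A p i * A q k - A p k * A q i := by
    rw [Matrix.det_one_add_mul_comm, Matrix.det_fin_two]
    simp [U, V, Pi.single_apply, hpq, hpq.symm]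
  have hMN : M * (1 + U * V) = (M.updateCol p (M.det • Pi.single i 1)).updateCol q
      (M.det • Pi.single k 1) := by
    ext x y
    have hUV : ∀ j, (U * V) j y = (if y = p then A j i - (Pi.single p 1 : n → R) j else 0) +
        (if y = q then A j k - (Pi.single q 1 : n → R) j else 0) := by
      intro j
      simp [U, V, Matrix.mul_apply, Fin.sum_univ_two, Pi.single_apply]
    rw [mul_add, mul_one, Matrix.add_apply, Matrix.mul_apply]
    simp only [hUV]
    by_cases hq : y = q
    · subst hq
      simp [hpq.symm, mul_sub, Finset.sum_sub_distrib, hMA, Pi.single_apply]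
    · by_cases hp : y = p
      · subst hp
        simp [hpq, mul_sub, Finset.sum_sub_distrib, hMA, Pi.single_apply]
      · simp [hp, hq]
  rw [← hN, ← Matrix.det_mul, hMN, Matrix.det_updateCol_smul, Matrix.updateCol_comm _ hpq,
    Matrix.det_updateCol_smul, Matrix.updateCol_comm _ hpq.symm]

lemma Matrix.det_updateCol_single {m : ℕ} {R : Type*} [CommRing R]
    (M : Matrix (Fin (m + 1)) (Fin (m + 1)) R) (p i : Fin (m + 1)) :
    (M.updateCol p (Pi.single i 1)).det =
      (-1) ^ (i + p : ℕ) * (M.submatrix i.succAbove p.succAbove).det := by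
  rw [← Matrix.adjugate_fin_succ_eq_det_submatrix, ← Matrix.transpose_apply M.adjugate,
    Matrix.adjugate_transpose, Matrix.adjugate_apply, Matrix.updateRow_transpose,
    Matrix.det_transpose]

/-- The Wronskian identity `Wr(Wr(f, v), Wr(g, v)) = Wr(f, g, v) Wr(v)`. -/
lemma wronskian_wronskian {s : ℕ} (f g : ℂ[X]) (v : Fin s → ℂ[X])
    (h0 : _root_.wronskian (Fin.cons f (Fin.cons g v : Fin (s + 1) → ℂ[X])) ≠ 0) :
    wrMap v f * derivative (wrMap v g) - derivative (wrMap v f) * wrMap v g =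
      _root_.wronskian (Fin.cons f (Fin.cons g v : Fin (s + 1) → ℂ[X])) *
        _root_.wronskian v := by
  set M := wrMatrix (Fin.cons f (Fin.cons g v : Fin (s + 1) → ℂ[X])) with hM
  rw [wronskian_eq_det_wrMatrix] at h0 ⊢
  have key := mul_left_cancel₀ h0 (Matrix.adjugate_minor_mul_det M
    (Fin.castSucc_lt_last (Fin.last s)).ne 0 1)
  have row0 : ∀ x : Fin (s + 1), (Fin.cons f (Fin.cons g v : Fin (s + 1) → ℂ[X]) :
      Fin (s + 2) → ℂ[X]) ((0 : Fin (s + 2)).succAbove x) =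
      (Fin.cons g v : Fin (s + 1) → ℂ[X]) x := by
    intro x
    simp
  have row1 : ∀ x : Fin (s + 1), (Fin.cons f (Fin.cons g v : Fin (s + 1) → ℂ[X]) :
      Fin (s + 2) → ℂ[X]) ((1 : Fin (s + 2)).succAbove x) =
      (Fin.cons f v : Fin (s + 1) → ℂ[X]) x := by
    intro x
    refine Fin.cases ?_ (fun x => ?_) x
    · simp
    · rw [← Fin.succ_zero_eq_one, Fin.succ_succAbove_succ]
      simp
  have a0 : (M.submatrix (Fin.succAbove 0) (Fin.last (s + 1)).succAbove).det = wrMap v g := by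
    rw [wrMap_apply, wronskian_eq_det_wrMatrix]
    congr 1
    ext x y : 2
    simp [hM, wrMatrix]
  have a1 : (M.submatrix (Fin.succAbove 1) (Fin.last (s + 1)).succAbove).det = wrMap v f := by
    rw [wrMap_apply, wronskian_eq_det_wrMatrix]
    congr 1
    ext x y : 2
    simp only [hM, wrMatrix, Matrix.submatrix_apply, Matrix.of_apply, row1]
    simp
  have b0 : (M.submatrix (Fin.succAbove 0) (Fin.last s).castSucc.succAbove).det =
      derivative (wrMap v g) := by
    rw [wrMap_apply, derivative_wronskian]
    congr 1
  have b1 : (M.submatrix (Fin.succAbove 1) (Fin.last s).castSucc.succAbove).det =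
      derivative (wrMap v f) := by
    rw [wrMap_apply, derivative_wronskian]
    congr 1
    ext x y : 2
    simp only [hM, wrMatrix, Matrix.submatrix_apply, Matrix.of_apply, row1]
  have c : ((M.updateCol (Fin.last s).castSucc (Pi.single 0 1)).updateCol (Fin.last (s + 1))
      (Pi.single 1 1)).det = _root_.wronskian v := by
    rw [Matrix.det_updateCol_single]
    have : (M.updateCol (Fin.last s).castSucc (Pi.single 0 1)).submatrix (Fin.succAbove 1)
        (Fin.last (s + 1)).succAbove = (M.submatrix (Fin.succAbove 1)
        (Fin.last (s + 1)).succAbove).updateCol (Fin.last s) (Pi.single 0 1) := by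
      ext x y : 2
      by_cases hy : y = Fin.last s
      · subst hy
        refine Fin.cases ?_ (fun x => ?_) x
        · simp
        · rw [← Fin.succ_zero_eq_one, Matrix.submatrix_apply, Fin.succ_succAbove_succ]
          simp
      · simp [hy]
    rw [this, Matrix.det_updateCol_single, Matrix.submatrix_submatrix, ← mul_assoc]
    have sgn : ((-1 : ℂ[X]) ^ (((1 : Fin (s + 2)) : ℕ) + (Fin.last (s + 1) : ℕ))) *
        (-1) ^ (((0 : Fin (s + 1)) : ℕ) + (Fin.last s : ℕ)) = 1 := by
      rw [← pow_add]
      exact Even.neg_one_pow ⟨s + 1, by simp; ring⟩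
    rw [sgn, one_mul, wronskian_eq_det_wrMatrix]
    congr 1
    ext x y : 2
    simp only [hM, wrMatrix, Matrix.submatrix_apply, Matrix.of_apply, Function.comp, row1]
    simp
  rw [c] at key
  simp only [Matrix.adjugate_fin_succ_eq_det_submatrix, a0, a1, b0, b1] at key
  rw [← key]
  have e : (-1 : ℂ[X]) ^ s * (-1) ^ s = 1 := by
    rw [← mul_pow]; simp
  simp only [Fin.val_zero, Fin.val_one, Fin.val_last, Fin.val_castSucc, pow_add, pow_zero, pow_one]
  linear_combination (-(wrMap v f * derivative (wrMap v g) -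
    derivative (wrMap v f) * wrMap v g)) * e

/-- The functional `g ↦ (gψ)'(z) y'(z) - (gψ)(z) y''(z)`. When `y` has a simple root at `z`, it
vanishes iff `gψ / y²` has no residue at `z`. -/
def residueMap (y ψ : ℂ[X]) (z : ℂ) : ℂ[X] →ₗ[ℂ] ℂ :=
  (derivative y).eval z • (leval z ∘ₗ derivative ∘ₗ LinearMap.mulRight ℂ ψ) -
    (derivative (derivative y)).eval z • (leval z ∘ₗ LinearMap.mulRight ℂ ψ)

lemma residueMap_apply (y ψ g : ℂ[X]) (z : ℂ) :
    residueMap y ψ z g = (derivative y).eval z * (derivative (g * ψ)).eval z -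
      (derivative (derivative y)).eval z * (g * ψ).eval z := rfl

lemma residueMap_wrMap {s : ℕ} (f g : ℂ[X]) (v : Fin s → ℂ[X]) {z : ℂ}
    (hz : (wrMap v g).eval z = 0) :
    residueMap (wrMap v g) (_root_.wronskian v) z
      (wrMap (Fin.cons g v : Fin (s + 1) → ℂ[X]) f) = 0 := by
  by_cases h0 : wrMap (Fin.cons g v : Fin (s + 1) → ℂ[X]) f = 0
  · rw [h0, map_zero]
  rw [residueMap_apply, wrMap_apply (Fin.cons g v : Fin (s + 1) → ℂ[X]),
    ← wronskian_wronskian f g v h0]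
  simp only [derivative_sub, derivative_mul, eval_sub, eval_add, eval_mul, hz]
  ring

/-- Degrees under `wrMap v`, for `f` whose coefficients at the degrees of the `v i` vanish. -/
lemma wrMap_ne_zero_and_natDegree {r : ℕ} {v : Fin r → ℂ[X]} (h0 : ∀ i, v i ≠ 0)
    (he : Function.Injective fun i => (v i).natDegree) {f : ℂ[X]} (hf : f ≠ 0)
    (hfv : ∀ i, f.natDegree ≠ (v i).natDegree) :
    wrMap v f ≠ 0 ∧
      (wrMap v f).natDegree + r = f.natDegree + (_root_.wronskian v).natDegree := by
  have h1 := (wronskian_ne_zero_and_natDegree h0 he).2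
  have h2 := wronskian_ne_zero_and_natDegree (g := (Fin.cons f v : Fin (r + 1) → ℂ[X]))
    (fun i => Fin.cases (by simpa using hf) (fun i => by simpa using h0 i) i) (by
      intro i j
      refine Fin.cases ?_ (fun i => ?_) i <;> refine Fin.cases ?_ (fun j => ?_) j
      · simp
      · intro h
        exact absurd h (by simpa using hfv j)
      · intro h
        exact absurd h.symm (by simpa using hfv i)
      · intro h
        exact congrArg Fin.succ (he (by simpa using h)))
  refine ⟨h2.1, ?_⟩
  have h3 := h2.2
  rw [Fin.sum_univ_castSucc, Fin.sum_univ_succ] at h3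
  simp only [Fin.val_castSucc, Fin.val_last, Fin.cons_zero, Fin.cons_succ] at h3
  rw [← wrMap_apply] at h3
  omega

lemma natDegree_ne_of_coeff_eq_zero {f : ℂ[X]} (hf : f ≠ 0) {d : ℕ} (h : f.coeff d = 0) :
    f.natDegree ≠ d := by
  rintro rfl
  exact hf (by simpa using h)

instance finiteDimensional_degreeLT (n : ℕ) : FiniteDimensional ℂ (degreeLT ℂ n) :=
  (degreeLTEquiv ℂ n).symm.finiteDimensional

lemma finrank_degreeLT_eq (n : ℕ) : Module.finrank ℂ (degreeLT ℂ n) = n := by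
  rw [(degreeLTEquiv ℂ n).finrank_eq]; simp

/-- The residue conditions at the simple roots of `y` are independent. -/
lemma residueMap_surjective {l n : ℕ} {t : Fin l → ℂ} (ht : Function.Injective t) {y ψ : ℂ[X]}
    (hyl : y.natDegree = l) (hy0 : ∀ j, y.eval (t j) = 0)
    (hy1 : ∀ j, (derivative y).eval (t j) ≠ 0) (hψ : ∀ j, ψ.eval (t j) ≠ 0) (hn : 2 * l < n) :
    Function.Surjective ((LinearMap.pi fun j => residueMap y ψ (t j)) ∘ₗ
      (degreeLT ℂ n).subtype) := by
  intro w
  let q : ℂ[X] := Lagrange.interpolate Finset.univ t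
    (fun j => w j / ((derivative y).eval (t j) ^ 2 * ψ.eval (t j)))
  have hq : ∀ j, q.eval (t j) = w j / ((derivative y).eval (t j) ^ 2 * ψ.eval (t j)) := fun j =>
    Lagrange.eval_interpolate_at_node _ ht.injOn (Finset.mem_univ j)
  have hqd : q.natDegree ≤ l := by
    refine natDegree_le_of_degree_le (le_of_lt ?_)
    simpa only [Finset.card_univ, Fintype.card_fin] using Lagrange.degree_interpolate_lt (s := Finset.univ) (v := t)
      (fun j => w j / ((derivative y).eval (t j) ^ 2 * ψ.eval (t j))) ht.injOn
  refine ⟨⟨y * q, ?_⟩, ?_⟩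
  · rw [mem_degreeLT]
    refine lt_of_le_of_lt degree_le_natDegree ?_
    have := natDegree_mul_le_of_le hyl.le hqd
    exact_mod_cast (by omega : (y * q).natDegree < n)
  · ext j
    have h1 := hy1 j
    have h2 := hψ j
    simp only [LinearMap.comp_apply, LinearMap.pi_apply, Submodule.subtype_apply,
      residueMap_apply, derivative_mul, eval_add, eval_mul, hy0, hq]
    field_simp
    ring

/-- A polynomial satisfying all residue conditions at the roots of `Wr(v)` lies in the image of
`wrMap v`. -/
lemma exists_wrMap_eq {r l : ℕ} {v : Fin r → ℂ[X]} (h0 : ∀ i, v i ≠ 0)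
    (he : Function.Injective fun i => (v i).natDegree)
    {t : Fin l → ℂ} (ht : Function.Injective t) {y ψ p : ℂ[X]}
    (hyl : y.natDegree = l) (hv : (_root_.wronskian v).natDegree = l)
    (hy0 : ∀ j, y.eval (t j) = 0)
    (hy1 : ∀ j, (derivative y).eval (t j) ≠ 0) (hψ : ∀ j, ψ.eval (t j) ≠ 0)
    (hres : ∀ f j, residueMap y ψ (t j) (wrMap v f) = 0)
    (hp : ∀ j, residueMap y ψ (t j) p = 0) :
    ∃ f : ℂ[X], (∀ i, f.coeff (v i).natDegree = 0) ∧ wrMap v f = p := by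
  obtain ⟨n, hn⟩ : ∃ n, n = p.natDegree + 1 + 2 * l := ⟨_, rfl⟩
  obtain ⟨m, hm⟩ : ∃ m, m = p.natDegree + 1 + l + r := ⟨_, rfl⟩
  let E : degreeLT ℂ m →ₗ[ℂ] (Fin r → ℂ) :=
    (LinearMap.pi fun i => lcoeff ℂ (v i).natDegree) ∘ₗ (degreeLT ℂ m).subtype
  let Φ : degreeLT ℂ n →ₗ[ℂ] (Fin l → ℂ) :=
    (LinearMap.pi fun j => residueMap y ψ (t j)) ∘ₗ (degreeLT ℂ n).subtype
  let T : LinearMap.ker E →ₗ[ℂ] ℂ[X] :=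
    wrMap v ∘ₗ (degreeLT ℂ m).subtype ∘ₗ (LinearMap.ker E).subtype
  have hE : ∀ f : LinearMap.ker E, ∀ i, (f : ℂ[X]).coeff (v i).natDegree = 0 := fun f i =>
    congrFun (LinearMap.mem_ker.1 f.2) i
  have hT : Function.Injective T := by
    intro f g hfg
    by_contra hne
    have hne' : (f : ℂ[X]) - g ≠ 0 := fun h => hne (Subtype.ext (Subtype.ext (sub_eq_zero.1 h)))
    refine (wrMap_ne_zero_and_natDegree h0 he hne' fun i =>
      natDegree_ne_of_coeff_eq_zero hne' (by rw [coeff_sub, hE f, hE g, sub_zero])).1 ?_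
    rw [map_sub]
    exact sub_eq_zero.2 hfg
  have hle : LinearMap.range T ≤ (LinearMap.ker Φ).map (degreeLT ℂ n).subtype := by
    rintro _ ⟨f, rfl⟩
    refine ⟨⟨T f, ?_⟩, ?_, rfl⟩
    · by_cases hne : f = 0
      · rw [hne, map_zero]; exact zero_mem _
      have hne' : (f : ℂ[X]) ≠ 0 := by simpa using hne
      obtain ⟨h1, h2⟩ := wrMap_ne_zero_and_natDegree h0 he hne'
        fun i => natDegree_ne_of_coeff_eq_zero hne' (hE f i)
      have h3 : (f : ℂ[X]).natDegree < m :=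
        (natDegree_lt_iff_degree_lt hne').2 (mem_degreeLT.1 f.1.2)
      rw [mem_degreeLT]
      refine (natDegree_lt_iff_degree_lt h1).1 ?_
      omega
    · exact LinearMap.mem_ker.2 (funext fun j => hres _ j)
  have hr1 : m ≤ r + Module.finrank ℂ (LinearMap.range T) := by
    rw [LinearMap.finrank_range_of_inj hT]
    have h1 := E.finrank_range_add_finrank_ker
    rw [finrank_degreeLT_eq] at h1
    have h2 := Submodule.finrank_le (LinearMap.range E)
    rw [Module.finrank_fin_fun] at h2
    omega
  have hr2 : Module.finrank ℂ ((LinearMap.ker Φ).map (degreeLT ℂ n).subtype) + l = n := by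
    have h1 := Φ.finrank_range_add_finrank_ker
    rw [LinearMap.range_eq_top.2 (residueMap_surjective ht hyl hy0 hy1 hψ (by omega)),
      finrank_top, Module.finrank_fin_fun, finrank_degreeLT_eq] at h1
    rw [Submodule.finrank_map_subtype_eq]
    omega
  have heq := Submodule.eq_of_le_of_finrank_le hle (by omega)
  have hpm : p ∈ (LinearMap.ker Φ).map (degreeLT ℂ n).subtype := by
    refine ⟨⟨p, ?_⟩, LinearMap.mem_ker.2 (funext fun j => hp j), rfl⟩
    rw [mem_degreeLT]
    refine lt_of_le_of_lt degree_le_natDegree ?_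
    exact_mod_cast (by omega : p.natDegree < n)
  rw [← heq] at hpm
  obtain ⟨f, hf⟩ := hpm
  exact ⟨f, hE f, hf⟩

/-- The monic polynomial with roots `s_1, …, s_l`. -/
def rootPoly {l : ℕ} (s : Fin l → ℂ) : ℂ[X] := ∏ i, (X - C (s i))

lemma monic_rootPoly {l : ℕ} (s : Fin l → ℂ) : (rootPoly s).Monic :=
  monic_prod_of_monic _ _ fun i _ => monic_X_sub_C (s i)

lemma natDegree_rootPoly {l : ℕ} (s : Fin l → ℂ) : (rootPoly s).natDegree = l := by
  rw [rootPoly, natDegree_prod_of_monic _ _ fun i _ => monic_X_sub_C (s i)]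
  simp

lemma eval_rootPoly_self {l : ℕ} (s : Fin l → ℂ) (j : Fin l) : (rootPoly s).eval (s j) = 0 := by
  rw [rootPoly, eval_prod]
  exact Finset.prod_eq_zero (Finset.mem_univ j) (by simp)

lemma eval_rootPoly_ne_zero {l : ℕ} {s : Fin l → ℂ} {z : ℂ} (h : ∀ i, z ≠ s i) :
    (rootPoly s).eval z ≠ 0 := by
  rw [rootPoly, eval_prod]
  exact Finset.prod_ne_zero_iff.2 fun i _ => by simpa using sub_ne_zero.2 (h i)

lemma eval_derivative_prod_X_sub_C {ι : Type*} [DecidableEq ι] (S : Finset ι) (u : ι → ℂ) {z : ℂ}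
    (h : ∀ i ∈ S, z ≠ u i) :
    (derivative (∏ i ∈ S, (X - C (u i)))).eval z =
      (∏ i ∈ S, (X - C (u i))).eval z * ∑ i ∈ S, 1 / (z - u i) := by
  rw [derivative_prod_finset, eval_finsetSum, Finset.mul_sum]
  refine Finset.sum_congr rfl fun i hi => ?_
  have h1 : z - u i ≠ 0 := sub_ne_zero.2 (h i hi)
  rw [← Finset.mul_prod_erase _ _ hi]
  simp only [derivative_X_sub_C, mul_one, eval_mul, eval_sub, eval_X, eval_C]
  field_simp

lemma rootPoly_eq_mul_prod_filter {l : ℕ} (s : Fin l → ℂ) (j : Fin l) :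
    rootPoly s = (X - C (s j)) * ∏ i ∈ Finset.univ.filter (fun i => i ≠ j), (X - C (s i)) := by
  rw [rootPoly, ← Finset.mul_prod_erase _ _ (Finset.mem_univ j)]
  congr 2
  ext i
  simp

lemma eval_derivative_rootPoly {l : ℕ} (s : Fin l → ℂ) (j : Fin l) :
    (derivative (rootPoly s)).eval (s j) =
      (∏ i ∈ Finset.univ.filter (fun i => i ≠ j), (X - C (s i))).eval (s j) := by
  rw [rootPoly_eq_mul_prod_filter s j, derivative_mul]
  simp

lemma eval_derivative_rootPoly_ne_zero {l : ℕ} {s : Fin l → ℂ} (hs : Function.Injective s)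
    (j : Fin l) : (derivative (rootPoly s)).eval (s j) ≠ 0 := by
  rw [eval_derivative_rootPoly, eval_prod]
  refine Finset.prod_ne_zero_iff.2 fun i hi => ?_
  simpa [sub_eq_zero] using fun h => (Finset.mem_filter.1 hi).2 (hs h).symm

lemma eval_derivative_derivative_rootPoly {l : ℕ} {s : Fin l → ℂ} (hs : Function.Injective s)
    (j : Fin l) : (derivative (derivative (rootPoly s))).eval (s j) =
      (derivative (rootPoly s)).eval (s j) *
        ∑ i ∈ Finset.univ.filter (fun i => i ≠ j), 2 / (s j - s i) := by
  have h := eval_derivative_prod_X_sub_C (Finset.univ.filter (fun i => i ≠ j)) s (z := s j)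
    (fun i hi h => (Finset.mem_filter.1 hi).2 (hs h).symm)
  rw [eval_derivative_rootPoly, rootPoly_eq_mul_prod_filter s j, derivative_mul, derivative_add,
    derivative_mul, derivative_mul]
  simp only [derivative_X_sub_C, derivative_one, zero_mul, one_mul, zero_add, eval_add, eval_mul,
    eval_sub, eval_X, eval_C, sub_self, add_zero, h]
  have h2 : ∑ i ∈ Finset.univ.filter (fun i => i ≠ j), 2 / (s j - s i) =
      2 * ∑ i ∈ Finset.univ.filter (fun i => i ≠ j), 1 / (s j - s i) := by
    rw [Finset.mul_sum]
    exact Finset.sum_congr rfl fun i _ => by ring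
  rw [h2]
  ring

/-- One Bethe ansatz equation is the vanishing of a residue. -/
lemma residueMap_rootPoly_eq_zero {k l m : ℕ} {u : Fin k → ℂ} {s : Fin l → ℂ} {w : Fin m → ℂ}
    (hs : Function.Injective s) (j : Fin l) (hu : ∀ i, s j ≠ u i) (hw : ∀ i, s j ≠ w i)
    (h : (∑ i, 1 / (s j - u i)) - (∑ i ∈ Finset.univ.filter (fun i => i ≠ j), 2 / (s j - s i)) +
      (∑ i, 1 / (s j - w i)) = 0) (c d : ℂ) :
    residueMap (C c * rootPoly s) (C d * rootPoly w) (s j) (rootPoly u) = 0 := by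
  rw [residueMap_apply]
  have h1 : (derivative (rootPoly u)).eval (s j) = _ :=
    eval_derivative_prod_X_sub_C Finset.univ u (fun i _ => hu i)
  have h2 : (derivative (rootPoly w)).eval (s j) = _ :=
    eval_derivative_prod_X_sub_C Finset.univ w (fun i _ => hw i)
  rw [← rootPoly] at h1 h2
  simp only [derivative_mul, eval_add, eval_mul, eval_C, h1, h2,
    eval_derivative_derivative_rootPoly hs, derivative_C, zero_mul, zero_add]
  linear_combination (c * d * (derivative (rootPoly s)).eval (s j) * (rootPoly u).eval (s j) *
    (rootPoly w).eval (s j)) * h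

lemma lseq_eq_add {N : ℕ} (lam : Fin N → ℕ) {a : ℕ} (ha : a < N) :
    lseq N lam a = lam ⟨a, ha⟩ + lseq N lam (a + 1) := by
  have : Finset.univ.filter (fun b : Fin N => a ≤ (b : ℕ)) =
      insert ⟨a, ha⟩ (Finset.univ.filter (fun b : Fin N => a + 1 ≤ (b : ℕ))) := by
    ext b
    simp only [Finset.mem_filter, Finset.mem_univ, true_and, Finset.mem_insert, Fin.ext_iff]
    omega
  rw [lseq, this, Finset.sum_insert (by simp)]
  rfl

lemma lseq_eq_zero {N : ℕ} (lam : Fin N → ℕ) {a : ℕ} (ha : N ≤ a) : lseq N lam a = 0 := by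
  rw [lseq, Finset.filter_false_of_mem, Finset.sum_empty]
  intro b _
  have := b.2
  omega

lemma degSeq_strictAnti {N : ℕ} {lam : Fin N → ℕ} (hlam : Antitone lam) :
    StrictAnti (degSeq N lam) := by
  intro i j hij
  have h1 := hlam hij.le
  have h2 := j.2
  have h3 : (i : ℕ) < j := hij
  simp only [degSeq]
  omega

/-- The entries of `f` from index `a` on. -/
def tailFrom {N : ℕ} (f : Fin N → ℂ[X]) (a m : ℕ) (h : a + m = N) : Fin m → ℂ[X] :=
  fun s => f ⟨a + s, by have := s.isLt; omega⟩

lemma wrTail_eq_wronskian_tailFrom {N : ℕ} (f : Fin N → ℂ[X]) {a m : ℕ} (h : a + m = N) :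
    wrTail f a = _root_.wronskian (tailFrom f a m h) := by
  obtain rfl : m = N - a := by omega
  rfl

lemma tailFrom_succ {N : ℕ} (f : Fin N → ℂ[X]) {a m : ℕ} (h : a + (m + 1) = N) :
    tailFrom f a (m + 1) h =
      Fin.cons (f ⟨a, by omega⟩) (tailFrom f (a + 1) m (by omega)) := by
  funext s
  refine Fin.cases ?_ (fun s => ?_) s
  · rfl
  · simp only [tailFrom, Fin.cons_succ, Fin.val_succ]
    congr 2
    omega

lemma wrTail_eq_wrMap {N : ℕ} (f : Fin N → ℂ[X]) {a m : ℕ} (h : a + (m + 1) = N) :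
    wrTail f a = wrMap (tailFrom f (a + 1) m (by omega)) (f ⟨a, by omega⟩) := by
  rw [wrTail_eq_wronskian_tailFrom f h, tailFrom_succ, wrMap_apply]

lemma wrTail_self {N : ℕ} (f : Fin N → ℂ[X]) : wrTail f N = 1 := by
  rw [wrTail_eq_wronskian_tailFrom f (m := 0) rfl, wronskian_eq_det_wrMatrix]
  exact Matrix.det_isEmpty

/-- The normalisation of the entries of a flag basis from index `a` on. -/
def IsFlagFrom {N : ℕ} (lam : Fin N → ℕ) (f : Fin N → ℂ[X]) (a : ℕ) : Prop :=
  ∀ i : Fin N, a ≤ i → (f i).Monic ∧ (f i).natDegree = degSeq N lam i ∧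
    ∀ j : Fin N, j ≠ i → (f i).coeff (degSeq N lam j) = 0

lemma IsFlagFrom.tailFrom_ne_zero {N : ℕ} {lam : Fin N → ℕ} {f : Fin N → ℂ[X]} {a m : ℕ}
    (hf : IsFlagFrom lam f a) (h : a + m = N) (s : Fin m) : tailFrom f a m h s ≠ 0 :=
  (hf _ (by simp)).1.ne_zero

lemma IsFlagFrom.natDegree_tailFrom {N : ℕ} {lam : Fin N → ℕ} {f : Fin N → ℂ[X]} {a m : ℕ}
    (hf : IsFlagFrom lam f a) (h : a + m = N) (s : Fin m) :
    (tailFrom f a m h s).natDegree = degSeq N lam ⟨a + s, by have := s.isLt; omega⟩ :=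
  (hf _ (by simp)).2.1

lemma IsFlagFrom.natDegree_tailFrom_injective {N : ℕ} {lam : Fin N → ℕ} (hlam : Antitone lam)
    {f : Fin N → ℂ[X]} {a m : ℕ} (hf : IsFlagFrom lam f a) (h : a + m = N) :
    Function.Injective fun s => (tailFrom f a m h s).natDegree := by
  intro s s' hss
  simp only [hf.natDegree_tailFrom] at hss
  have := (degSeq_strictAnti hlam).injective hss
  simp only [Fin.mk.injEq] at this
  exact Fin.ext (by omega)

/-- A flag basis can be constructed from its last entry to its first one. -/
lemma exists_isFlagFrom {N : ℕ} {lam : Fin N → ℕ} (hlam : Antitone lam)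
    {t : (a : ℕ) → Fin (lseq N lam a) → ℂ} (hsimple : ∀ a < N, Function.Injective (t a))
    (hdisj : ∀ a : ℕ, 1 ≤ a → a < N →
      ∀ (j : Fin (lseq N lam a)) (j' : Fin (lseq N lam (a - 1))), t a j ≠ t (a - 1) j')
    (hBAE : BAE N lam t) (m : ℕ) : ∀ a, a + m = N →
    ∃ f : Fin N → ℂ[X], IsFlagFrom lam f a ∧
      ∀ b, a ≤ b → b ≤ N → ∃ c : ℂ, c ≠ 0 ∧ wrTail f b = C c * rootPoly (t b) := by
  induction m with
  | zero =>
    intro a ha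
    refine ⟨0, fun i hi => absurd i.2 (by omega), fun b hb hb' => ⟨1, one_ne_zero, ?_⟩⟩
    obtain rfl : b = N := by omega
    have : IsEmpty (Fin (lseq b lam b)) := by
      rw [lseq_eq_zero lam le_rfl]
      infer_instance
    simp [wrTail_self, rootPoly]
  | succ m ih =>
    intro a ha
    have haN : a < N := by omega
    obtain ⟨f, hf, hy⟩ := ih (a + 1) (by omega)
    have h' : (a + 1) + m = N := by omega
    obtain ⟨c, hc, hyc⟩ := hy (a + 1) le_rfl (by omega)
    have hlt : Fin (lseq N lam (a + 1)) → a + 1 < N := by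
      intro j
      by_contra hcon
      have h1 := j.2
      have h2 := lseq_eq_zero lam (not_lt.1 hcon)
      omega
    have hinj : Function.Injective (t (a + 1)) := fun j j' hjj => hsimple (a + 1) (hlt j) hjj
    have hdown : ∀ j i, t (a + 1) j ≠ t a i := fun j i => hdisj (a + 1) (by omega) (hlt j) j i
    have hup : ∀ j i, t (a + 1) j ≠ t (a + 2) i := by
      intro j i
      have h2 : a + 2 < N := by
        by_contra hcon
        have h1 := i.2
        have h2 := lseq_eq_zero lam (not_lt.1 hcon)
        omega
      exact (hdisj (a + 2) (by omega) h2 i j).symm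
    set v := tailFrom f (a + 1) m h' with hv
    have hv0 := hf.tailFrom_ne_zero h'
    have hvi := hf.natDegree_tailFrom_injective hlam h'
    have hvw : _root_.wronskian v = C c * rootPoly (t (a + 1)) := by
      rw [← hyc, wrTail_eq_wronskian_tailFrom f h']
    have hvd : (_root_.wronskian v).natDegree = lseq N lam (a + 1) := by
      rw [hvw, natDegree_C_mul hc, natDegree_rootPoly]
    obtain ⟨g, hg0, hg⟩ := exists_wrMap_eq (y := _root_.wronskian v) (ψ := wrTail f (a + 2))
      (p := rootPoly (t a)) hv0 hvi hinj hvd hvd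
      (fun j => by rw [hvw, eval_mul, eval_rootPoly_self, mul_zero])
      (fun j => by
        rw [hvw, derivative_C_mul, eval_mul, eval_C]
        exact mul_ne_zero hc (eval_derivative_rootPoly_ne_zero hinj j))
      (fun j => by
        obtain ⟨d, hd, hyd⟩ := hy (a + 2) (by omega) (hlt j)
        rw [hyd, eval_mul, eval_C]
        exact mul_ne_zero hd (eval_rootPoly_ne_zero (hup j)))
      (fun q j => by
        have h3 := hlt j
        obtain ⟨m, rfl⟩ : ∃ k, m = k + 1 := ⟨m - 1, by omega⟩
        have hz : (_root_.wronskian v).eval (t (a + 1) j) = 0 := by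
          rw [hvw, eval_mul, eval_rootPoly_self, mul_zero]
        rw [wrTail_eq_wronskian_tailFrom f (m := m) (by omega)]
        rw [hv, tailFrom_succ, ← wrMap_apply] at hz ⊢
        exact residueMap_wrMap q _ _ hz)
      (fun j => by
        obtain ⟨d, hd, hyd⟩ := hy (a + 2) (by omega) (hlt j)
        rw [hvw, hyd]
        exact residueMap_rootPoly_eq_zero hinj j (hdown j) (hup j)
          (hBAE (a + 1) (by omega) (hlt j) j) c d)
    have hgne : g ≠ 0 := by
      rintro rfl
      rw [map_zero] at hg
      exact (monic_rootPoly (t a)).ne_zero hg.symm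
    have hgd : g.natDegree = degSeq N lam ⟨a, haN⟩ := by
      have h1 := (wrMap_ne_zero_and_natDegree hv0 hvi hgne
        fun i => natDegree_ne_of_coeff_eq_zero hgne (hg0 i)).2
      rw [hg, natDegree_rootPoly, hvd, lseq_eq_add lam haN] at h1
      simp only [degSeq]
      omega
    set e := g.leadingCoeff with he
    have hene : e ≠ 0 := leadingCoeff_ne_zero.2 hgne
    set f' := Function.update f ⟨a, haN⟩ (e⁻¹ • g) with hf'
    have hf'a : f' ⟨a, haN⟩ = e⁻¹ • g := by simp [hf']
    have hf'i : ∀ i : Fin N, a + 1 ≤ i → f' i = f i := fun i hi => by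
      rw [hf', Function.update_of_ne]
      rintro rfl
      simp at hi
    have htail : ∀ b, a + 1 ≤ b → ∀ k (hk : b + k = N),
        tailFrom f' b k hk = tailFrom f b k hk := fun b hb k hk => funext fun s =>
      hf'i _ (by simp only; omega)
    refine ⟨f', fun i hi => ?_, fun b hb hbN => ?_⟩
    · rcases hi.eq_or_lt with hi | hi
      · obtain rfl : i = ⟨a, haN⟩ := Fin.ext hi.symm
        rw [hf'a]
        refine ⟨?_, ?_, fun j hj => ?_⟩
        · rw [Monic, smul_eq_C_mul, leadingCoeff_C_mul_of_isUnit (inv_ne_zero hene).isUnit, ← he,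
            inv_mul_cancel₀ hene]
        · rw [smul_eq_C_mul, natDegree_C_mul (inv_ne_zero hene), hgd]
        · rw [coeff_smul]
          rcases lt_or_gt_of_ne hj with hj | hj
          · rw [coeff_eq_zero_of_natDegree_lt, smul_zero]
            rw [hgd]
            exact degSeq_strictAnti hlam hj
          · have hj' : a < (j : ℕ) := hj
            have h1 := hg0 ⟨j - (a + 1), by omega⟩
            rw [hf.natDegree_tailFrom] at h1
            have h2 : (⟨a + 1 + (j - (a + 1)), by omega⟩ : Fin N) = j :=
              Fin.ext (by simp only; omega)
            rw [h2] at h1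
            rw [h1, smul_zero]
      · rw [hf'i i hi]
        exact hf i hi
    · rcases hb.eq_or_lt with rfl | hb
      · refine ⟨e⁻¹, inv_ne_zero hene, ?_⟩
        rw [wrTail_eq_wrMap f' ha, htail _ le_rfl, hf'a, map_smul, hg, smul_eq_C_mul]
      · obtain ⟨d, hd, hyd⟩ := hy b hb hbN
        refine ⟨d, hd, ?_⟩
        rw [← hyd, wrTail_eq_wronskian_tailFrom f' (m := N - b) (by omega), htail b hb,
          wrTail_eq_wronskian_tailFrom]

/-- The tail Wronskians determine the normalised flag basis. -/
lemma IsFlagFrom.eq_of_wrTail {N : ℕ} {lam : Fin N → ℕ} (hlam : Antitone lam)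
    {f g : Fin N → ℂ[X]} (hf : IsFlagFrom lam f 0) (hg : IsFlagFrom lam g 0) {y : ℕ → ℂ[X]}
    (hfy : ∀ a < N, ∃ c : ℂ, c ≠ 0 ∧ wrTail f a = C c * y a)
    (hgy : ∀ a < N, ∃ c : ℂ, c ≠ 0 ∧ wrTail g a = C c * y a) : f = g := by
  have key : ∀ m a, a + m = N → ∀ i : Fin N, a ≤ i → f i = g i := by
    intro m
    induction m with
    | zero => exact fun a ha i hi => absurd i.2 (by omega)
    | succ m ih =>
      intro a ha i hi
      rcases hi.eq_or_lt with hi | hi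
      swap
      · exact ih (a + 1) (by omega) i hi
      have haN : a < N := by omega
      obtain rfl : i = ⟨a, haN⟩ := Fin.ext hi.symm
      have h' : a + 1 + m = N := by omega
      have htail : tailFrom g (a + 1) m h' = tailFrom f (a + 1) m h' := funext fun s =>
        (ih (a + 1) h' _ (by simp)).symm
      have hf' : IsFlagFrom lam f (a + 1) := fun i _ => hf i (Nat.zero_le _)
      obtain ⟨c, hc, hfc⟩ := hfy a haN
      obtain ⟨d, hd, hgd⟩ := hgy a haN
      rw [wrTail_eq_wrMap _ ha] at hfc hgd
      rw [htail] at hgd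
      obtain ⟨hf1, hf2, hf3⟩ := hf ⟨a, haN⟩ (Nat.zero_le _)
      obtain ⟨hg1, hg2, hg3⟩ := hg ⟨a, haN⟩ (Nat.zero_le _)
      have h0 : d • f ⟨a, haN⟩ - c • g ⟨a, haN⟩ = 0 := by
        by_contra hne
        refine (wrMap_ne_zero_and_natDegree (hf'.tailFrom_ne_zero h')
          (hf'.natDegree_tailFrom_injective hlam h') hne fun s =>
            natDegree_ne_of_coeff_eq_zero hne ?_).1 ?_
        · have hs : (⟨a + 1 + s, by omega⟩ : Fin N) ≠ ⟨a, haN⟩ := by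
            simp only [ne_eq, Fin.mk.injEq]
            omega
          rw [hf'.natDegree_tailFrom, coeff_sub, coeff_smul, coeff_smul, hf3 _ hs, hg3 _ hs]
          simp
        · rw [map_sub, map_smul, map_smul, hfc, hgd, smul_eq_C_mul, smul_eq_C_mul]
          ring
      have hcd : d = c := by
        have h1 := congrArg (fun p => p.coeff (degSeq N lam ⟨a, haN⟩)) h0
        have h2 : (f ⟨a, haN⟩).coeff (degSeq N lam ⟨a, haN⟩) = 1 := by
          rw [← hf2]; exact hf1
        have h3 : (g ⟨a, haN⟩).coeff (degSeq N lam ⟨a, haN⟩) = 1 := by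
          rw [← hg2]; exact hg1
        simpa [h2, h3, sub_eq_zero] using h1
      rw [hcd, ← smul_sub] at h0
      exact sub_eq_zero.1 ((smul_eq_zero.1 h0).resolve_left hc)
  exact funext fun i => key N 0 (by omega) i (Nat.zero_le _)

lemma IsFlagFrom.linearIndependent {N : ℕ} {lam : Fin N → ℕ} {f : Fin N → ℂ[X]}
    (hf : IsFlagFrom lam f 0) : LinearIndependent ℂ f := by
  rw [Fintype.linearIndependent_iff]
  intro c hc i
  have h1 := congrArg (fun p => p.coeff (degSeq N lam i)) hc
  obtain ⟨hf1, hf2, -⟩ := hf i (Nat.zero_le _)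
  have h2 : (f i).coeff (degSeq N lam i) = 1 := by
    rw [← hf2]; exact hf1
  simp only [finsetSum_coeff, coeff_smul, coeff_zero, smul_eq_mul] at h1
  rw [Finset.sum_eq_single i] at h1
  · simpa [h2] using h1
  · intro j _ hj
    rw [(hf j (Nat.zero_le _)).2.2 i hj.symm, mul_zero]
  · simp

/-- a solution `t` of the Bethe ansatz equations, with pairwise distinct
coordinates within each level and disjoint consecutive levels, determines a unique
`X ∈ Ω_λ` whose polynomials `y_a` are `∏_j (u − t^{(a)}_j)`; this `X` is then generic
and `t` are its root coordinates. -/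
theorem statement6 (N : ℕ) (hN : 1 ≤ N) (lam : Fin N → ℕ) (hlam : Antitone lam)
    (t : (a : ℕ) → Fin (lseq N lam a) → ℂ)
    (hsimple : ∀ a < N, Function.Injective (t a))
    (hdisj : ∀ a : ℕ, 1 ≤ a → a < N →
      ∀ (j : Fin (lseq N lam a)) (j' : Fin (lseq N lam (a - 1))), t a j ≠ t (a - 1) j')
    (hBAE : BAE N lam t) :
    ∃! X : Submodule ℂ (Polynomial ℂ), X ∈ Omega N lam ∧
      ∃ f : Fin N → Polynomial ℂ, IsFlagBasis N lam X f ∧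
        ∀ a < N, ∃ c : ℂ, c ≠ 0 ∧
          wrTail f a =
            Polynomial.C c *
              ∏ j : Fin (lseq N lam a), (Polynomial.X - Polynomial.C (t a j)) := by
  obtain ⟨f, hf, hy⟩ := exists_isFlagFrom hlam hsimple hdisj hBAE N 0 (by omega)
  have hfy : ∀ a < N, ∃ c : ℂ, c ≠ 0 ∧ wrTail f a = C c * rootPoly (t a) :=
    fun a ha => hy a (Nat.zero_le _) ha.le
  refine ⟨Submodule.span ℂ (Set.range f), ⟨⟨?_, fun i => ⟨f i, ?_, ?_⟩⟩,
    f, ⟨hf.linearIndependent, rfl, fun i => hf i (Nat.zero_le _)⟩, hfy⟩, ?_⟩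
  · rw [finrank_span_eq_card hf.linearIndependent, Fintype.card_fin]
  · exact Submodule.subset_span ⟨i, rfl⟩
  · obtain ⟨h1, h2, -⟩ := hf i (Nat.zero_le _)
    rw [degree_eq_natDegree h1.ne_zero, h2]
  · rintro X ⟨-, g, ⟨-, hspan, hg⟩, hgy⟩
    rw [← hspan, IsFlagFrom.eq_of_wrTail hlam (fun i _ => hg i) hf (y := fun a => rootPoly (t a))
      hgy hfy]
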